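/- For partitions λ ⊆ Λ in the k×(n−k) rectangle with μ/λ a rim hook, let L(μ/λ) be defined as w_λ·M(w_λ⁻¹ w_μ) = {w_λ(i) : w_λ(i) ≠ w_μ(i)}. If μ/λ is a rim hook of size r', then L(μ/λ) consists of exactly r'+1 consecutive integers. -/

import Mathlib

/-- `w` is the Grassmannian permutation of the partition `lam` (inside the
`k×(n−k)` rectangle, `lam 0 = λ_1 ≥ lam 1 = λ_2 ≥ …`) with descent at `k`:
in 0-indexed terms, for positions `p < k` one has
`w(p) = λ_{k−p} + p` (i.e. 1-indexed `w(k−i+1) = λ_i + (k−i+1)`), and the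
remaining values occupy positions `≥ k` in increasing order. -/
def IsGrassmannian (n k : ℕ) (lam : Fin k → ℕ) (w : Equiv.Perm (Fin n)) : Prop :=
  (∀ p : Fin n, ∀ hp : p.val < k,
      (w p).val = lam ⟨k - 1 - p.val, by omega⟩ + p.val) ∧
    ∀ p q : Fin n, k ≤ p.val → p < q → w p < w q

/-- `mu/lam` is a rim hook (border strip): `lam ⊆ mu`, the skew shape is
nonempty, its nonempty rows are contiguous, and consecutive nonempty rows
overlap in exactly one column (`mu_{i+1} = lam_i + 1`), i.e. the shape is
edgewise connected with no `2×2` square. -/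
def IsRimHook (k : ℕ) (lam mu : Fin k → ℕ) : Prop :=
  (∀ i, lam i ≤ mu i) ∧ (∃ i, lam i < mu i) ∧
    (∀ i m j : Fin k, i ≤ m → m ≤ j → lam i < mu i → lam j < mu j → lam m < mu m) ∧
    ∀ i j : Fin k, j.val = i.val + 1 → lam i < mu i → lam j < mu j → mu j = lam i + 1


/-- counting lemma -/
lemma grass_count (n k : ℕ) (hkn : k < n) (w : Equiv.Perm (Fin n)) (a : ℕ → ℕ)
    (ha : StrictMono a) (hwa : ∀ p : Fin n, p.val < k → (w p).val = a p)
    (hinc : ∀ p q : Fin n, k ≤ p.val → p < q → w p < w q) (p : Fin n) (hp : k ≤ p.val) :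
    (w p).val + k = p.val + ((Finset.range k).filter fun q => a q < (w p).val).card := by
  have h1 : (Finset.univ.filter fun q : Fin n => w q < w p).card = (w p).val := by
    have : (Finset.univ.filter fun q : Fin n => w q < w p) = (Finset.Iio (w p)).map w.symm.toEmbedding := by
      ext q
      simp
    rw [this, Finset.card_map, Fin.card_Iio]
  have h2 : (Finset.univ.filter fun q : Fin n => w q < w p).map Fin.valEmbedding =
      ((Finset.range k).filter fun q => a q < (w p).val) ∪ Finset.Ico k p.val := by
    ext q
    simp only [Finset.mem_map, Finset.mem_filter, Finset.mem_univ, true_and, Finset.mem_union,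
      Finset.mem_range, Finset.mem_Ico, Fin.valEmbedding_apply]
    constructor
    · rintro ⟨x, hx, rfl⟩
      by_cases hxk : x.val < k
      · left
        rw [← hwa x hxk]
        exact ⟨hxk, hx⟩
      · right
        refine ⟨by omega, ?_⟩
        by_contra hc
        rcases lt_or_eq_of_le (not_lt.mp hc) with h | h
        · exact absurd (hinc p x hp h) (not_lt.mpr hx.le)
        · have : p = x := Fin.ext h
          subst this
          exact lt_irrefl _ hx
    · rintro (⟨h1, h2⟩ | ⟨h1, h2⟩)
      · refine ⟨⟨q, by omega⟩, ?_, rfl⟩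
        rw [Fin.lt_def, hwa _ h1]
        exact h2
      · exact ⟨⟨q, by omega⟩, hinc _ _ h1 h2, rfl⟩
  have h3 := congrArg Finset.card h2
  rw [Finset.card_map, h1, Finset.card_union_of_disjoint, Nat.card_Ico] at h3
  · omega
  · rw [Finset.disjoint_left]
    intro x hx hx'
    simp at hx hx'
    omega

lemma tele_sum (k P Q : ℕ) (a b : ℕ → ℕ) (hPQ : P ≤ Q) (hQk : Q < k)
    (hlt : ∀ q, P ≤ q → q ≤ Q → a q < b q)
    (hout : ∀ q, q < k → (q < P ∨ Q < q) → a q = b q)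
    (hstep : ∀ q, P ≤ q → q < Q → b q = a (q + 1)) :
    a P + ∑ q ∈ Finset.range k, (b q - a q) = b Q := by
  have key : ∀ m, m ≤ k → (m ≤ P → ∑ q ∈ Finset.range m, (b q - a q) = 0) ∧
      (P < m → m ≤ Q + 1 → a P + ∑ q ∈ Finset.range m, (b q - a q) = b (m - 1)) ∧
      (Q < m → a P + ∑ q ∈ Finset.range m, (b q - a q) = b Q) := by
    intro m
    induction m with
    | zero => intro _; simp
    | succ m ih =>
      intro hm
      obtain ⟨i1, i2, i3⟩ := ih (by omega)
      rw [Finset.sum_range_succ]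
      have mid : P < m + 1 → m + 1 ≤ Q + 1 →
          a P + (∑ q ∈ Finset.range m, (b q - a q) + (b m - a m)) = b m := by
        intro h1 h2
        have := hlt m (by omega) (by omega)
        rcases Nat.lt_or_ge P m with h | h
        · have e := i2 h (by omega)
          have s := hstep (m - 1) (by omega) (by omega)
          rw [Nat.sub_add_cancel (by omega)] at s
          omega
        · have e := i1 h
          have : P = m := by omega
          subst this
          omega
      refine ⟨?_, mid, ?_⟩
      · intro h
        have := hout m (by omega) (by omega)
        have := i1 (by omega)
        omega
      · intro h
        rcases Nat.lt_or_ge Q m with h' | h'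
        · have := hout m (by omega) (by omega)
          have := i3 h'
          omega
        · have : m = Q := by omega
          subst this
          exact mid (by omega) (by omega)
  exact (key k le_rfl).2.2 hQk

/-- For a rim hook `μ/λ` of size `r' = Σ (μ_i − λ_i)` inside the `k×(n−k)`
rectangle, the set `L(μ/λ) = w_λ·M(w_λ⁻¹ w_μ) = {w_λ(i) : w_λ(i) ≠ w_μ(i)}`
consists of exactly `r'+1` consecutive integers. -/
theorem stmt19 (n k : ℕ) (hk : 1 ≤ k) (hkn : k < n)
    (lam mu : Fin k → ℕ) (hlam : Antitone lam) (hmu : Antitone mu)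
    (hlb : ∀ i, lam i ≤ n - k) (hmb : ∀ i, mu i ≤ n - k)
    (hrim : IsRimHook k lam mu)
    (wl wm : Equiv.Perm (Fin n))
    (hwl : IsGrassmannian n k lam wl) (hwm : IsGrassmannian n k mu wm) :
    ∃ c : ℕ,
      (Finset.univ.filter fun i : Fin n => wl i ≠ wm i).image wl =
        Finset.univ.filter fun x : Fin n =>
          c ≤ x.val ∧ x.val ≤ c + ∑ i : Fin k, (mu i - lam i) := by
  obtain ⟨hle, ⟨i0, hi0⟩, hcont, hadj⟩ := hrim
  obtain ⟨hl1, hl2⟩ := hwl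
  obtain ⟨hm1, hm2⟩ := hwm
  set a : ℕ → ℕ := fun p => lam ⟨k - 1 - p, by omega⟩ + p with ha_def
  set b : ℕ → ℕ := fun p => mu ⟨k - 1 - p, by omega⟩ + p with hb_def
  have ha : StrictMono a := by
    intro p q h
    have : lam ⟨k - 1 - p, by omega⟩ ≤ lam ⟨k - 1 - q, by omega⟩ :=
      hlam (by rw [Fin.mk_le_mk]; omega)
    simp only [ha_def]
    omega
  have hb : StrictMono b := by
    intro p q h
    have : mu ⟨k - 1 - p, by omega⟩ ≤ mu ⟨k - 1 - q, by omega⟩ :=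
      hmu (by rw [Fin.mk_le_mk]; omega)
    simp only [hb_def]
    omega
  have hab : ∀ p, a p ≤ b p := fun p => Nat.add_le_add_right (hle _) p
  have hab' : ∀ p, a p < b p ↔ lam ⟨k - 1 - p, by omega⟩ < mu ⟨k - 1 - p, by omega⟩ := by
    intro p
    simp only [ha_def, hb_def]
    omega
  let S := (Finset.range k).filter fun p => a p < b p
  have hS : S.Nonempty := by
    refine ⟨k - 1 - i0.val, ?_⟩
    have := i0.isLt
    simp only [S, Finset.mem_filter, Finset.mem_range]
    refine ⟨by omega, ?_⟩
    rw [hab']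
    have e : (⟨k - 1 - (k - 1 - i0.val), by omega⟩ : Fin k) = i0 := Fin.ext (by simp; omega)
    rw [e]
    exact hi0
  obtain ⟨P, hPS, hPmin⟩ : ∃ P ∈ S, ∀ x ∈ S, P ≤ x := ⟨_, S.min'_mem hS, fun x hx => S.min'_le x hx⟩
  obtain ⟨Q, hQS, hQmax⟩ : ∃ P ∈ S, ∀ x ∈ S, x ≤ P := ⟨_, S.max'_mem hS, fun x hx => S.le_max' x hx⟩
  simp only [S, Finset.mem_filter, Finset.mem_range] at hPS hQS hPmin hQmax
  have hPQ : P ≤ Q := hPmin Q hQS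
  have hQk := hQS.1
  have hlt : ∀ q, P ≤ q → q ≤ Q → a q < b q := by
    intro q h1 h2
    rw [hab']
    exact hcont ⟨k - 1 - Q, by omega⟩ _ ⟨k - 1 - P, by omega⟩ (by rw [Fin.mk_le_mk]; omega)
      (by rw [Fin.mk_le_mk]; omega) ((hab' Q).1 hQS.2) ((hab' P).1 hPS.2)
  have hout : ∀ q, q < k → (q < P ∨ Q < q) → a q = b q := by
    intro q hq h
    by_contra hne
    have h' : a q < b q := lt_of_le_of_ne (hab q) hne
    have := hPmin q ⟨hq, h'⟩
    have := hQmax q ⟨hq, h'⟩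
    omega
  have hstep : ∀ q, P ≤ q → q < Q → b q = a (q + 1) := by
    intro q h1 h2
    have := hadj ⟨k - 1 - (q + 1), by omega⟩ ⟨k - 1 - q, by omega⟩ (by simp only []; omega)
      ((hab' _).1 (hlt (q + 1) (by omega) (by omega))) ((hab' _).1 (hlt q h1 (by omega)))
    simp only [ha_def, hb_def]
    omega
  have hsum : ∑ i : Fin k, (mu i - lam i) = ∑ q ∈ Finset.range k, (b q - a q) := by
    rw [Finset.sum_range, ← Equiv.sum_comp Fin.revPerm]
    refine Finset.sum_congr rfl fun i _ => ?_
    have e : (Fin.revPerm i : Fin k) = ⟨k - 1 - i.val, by omega⟩ := Fin.ext (by simp; omega)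
    rw [e]
    simp only [ha_def, hb_def]
    omega
  have hc : a P + ∑ i : Fin k, (mu i - lam i) = b Q := by
    rw [hsum]
    exact tele_sum k P Q a b hPQ hQk hlt hout hstep
  have hwa : ∀ p : Fin n, p.val < k → (wl p).val = a p := fun p hp => hl1 p hp
  have hwb : ∀ p : Fin n, p.val < k → (wm p).val = b p := fun p hp => hm1 p hp
  have cl := grass_count n k hkn wl a ha hwa hl2
  have cm := grass_count n k hkn wm b hb hwb hm2
  have hin : ∀ q, P ≤ q → q ≤ Q → a P ≤ a q ∧ a q < b q ∧ b q ≤ b Q := fun q h1 h2 =>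
    ⟨ha.monotone h1, hlt q h1 h2, hb.monotone h2⟩
  have hmain : ∀ p : Fin n, wl p ≠ wm p ↔ a P ≤ (wl p).val ∧ (wl p).val ≤ b Q := by
    intro p
    rw [Ne, Fin.ext_iff]
    by_cases hp : p.val < k
    · rw [hwa p hp, hwb p hp]
      rcases Nat.lt_or_ge p.val P with h | h
      · have := hout p hp (Or.inl h)
        have := ha h
        omega
      · rcases Nat.lt_or_ge Q p.val with h' | h'
        · have := hout p hp (Or.inr h')
          have := hb h'
          omega
        · have := hin p h h'
          omega
    · have hp' : k ≤ p.val := not_lt.mp hp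
      have hnA : ∀ q, q < k → a q ≠ (wl p).val := by
        intro q hq he
        have := hwa ⟨q, by omega⟩ hq
        have := wl.injective (Fin.ext (this.trans he))
        rw [← this] at hp
        exact hp hq
      have hnB : ∀ q, q < k → b q ≠ (wm p).val := by
        intro q hq he
        have := hwb ⟨q, by omega⟩ hq
        have := wm.injective (Fin.ext (this.trans he))
        rw [← this] at hp
        exact hp hq
      constructor
      · contrapose
        intro hv
        obtain ⟨p', hp'e⟩ := wm.surjective (wl p)
        have hp'k : k ≤ p'.val := by
          by_contra hlt'
          have hlt' := not_le.mp hlt'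
          have e := hwb p' hlt'
          rw [hp'e] at e
          rcases Nat.lt_or_ge p'.val P with h | h
          · exact hnA p' hlt' ((hout p' hlt' (Or.inl h)).trans e.symm)
          · rcases Nat.lt_or_ge Q p'.val with h' | h'
            · exact hnA p' hlt' ((hout p' hlt' (Or.inr h')).trans e.symm)
            · have := hin p' h h'
              omega
        have c1 := cl p hp'
        have c2 := cm p' hp'k
        rw [hp'e] at c2
        have : ((Finset.range k).filter fun q => a q < (wl p).val) =
            ((Finset.range k).filter fun q => b q < (wl p).val) := by
          refine Finset.filter_congr fun q hq => ?_
          rw [Finset.mem_range] at hq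
          rcases Nat.lt_or_ge q P with h | h
          · rw [hout q hq (Or.inl h)]
          · rcases Nat.lt_or_ge Q q with h' | h'
            · rw [hout q hq (Or.inr h')]
            · have := hin q h h'
              omega
        rw [this] at c1
        have : p' = p := Fin.ext (by omega)
        rw [← this, hp'e, this]
      · rintro ⟨h1, h2⟩ he
        have c1 := cl p hp'
        have c2 := cm p hp'
        rw [← he] at c2 hnB
        have hss : ((Finset.range k).filter fun q => b q < (wl p).val) ⊂
            ((Finset.range k).filter fun q => a q < (wl p).val) := by
          rw [Finset.ssubset_iff_of_subset]
          · by_contra hno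
            simp only [Finset.mem_filter, Finset.mem_range, not_exists, not_and] at hno
            have hno : ∀ x, x < k → a x < (wl p).val → b x < (wl p).val := fun x h3 h4 => by
              by_contra h5
              exact hno x ⟨h3, h4⟩ (fun _ => h5)
            have hall : ∀ j, P + j ≤ Q → a (P + j) < (wl p).val := by
              intro j
              induction j with
              | zero =>
                intro _
                exact lt_of_le_of_ne h1 (hnA P (by omega))
              | succ j ih =>
                intro hj
                have := hno (P + j) (by omega) (ih (by omega))
                rw [hstep (P + j) (by omega) (by omega)] at this
                exact this
            have := hall (Q - P) (by omega)
            rw [Nat.add_sub_cancel' hPQ] at this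
            have := hno Q hQk this
            omega
          · intro q
            simp only [Finset.mem_filter, Finset.mem_range]
            exact fun h => ⟨h.1, lt_of_le_of_lt (hab q) h.2⟩
        have := Finset.card_lt_card hss
        omega
  refine ⟨a P, ?_⟩
  rw [hc]
  ext x
  simp only [Finset.mem_image, Finset.mem_filter, Finset.mem_univ, true_and]
  constructor
  · rintro ⟨p, hp, rfl⟩
    exact (hmain p).1 hp
  · intro hx
    obtain ⟨p, rfl⟩ := wl.surjective x
    exact ⟨p, (hmain p).2 hx, rfl⟩
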